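/- Let ε > 0. There is a constant C(ε) > 0 such that for all real X, D ≥ 1 and any complex numbers ξ_n indexed by integers n ∈ [X, 2X], one has ∑_{d ∈ [D,2D] ∩ ℤ} | ∑_{n ∈ [X,2X] ∩ ℤ, d | n} ξ_n |^2 ≤ C(ε) · (X·D^{ε−1} + D) · ∑_{n ∈ [X,2X] ∩ ℤ} |ξ_n|^2. -/

import Mathlib

open Finset

/-- A Schur test: if the rows of the Gram matrix of a nonnegative matrix `a` have sum at most `K`,
then `a` has squared operator norm at most `K`. -/
theorem sum_sq_sum_mul_le_of_gram_row_sum_le {ι κ : Type*} {s : Finset ι} {t : Finset κ}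
    {a : ι → κ → ℝ} {K : ℝ} (ha : ∀ i n, 0 ≤ a i n) (hK : 0 ≤ K)
    (h : ∀ i ∈ s, ∑ j ∈ s, ∑ n ∈ t, a i n * a j n ≤ K) (x : κ → ℝ) :
    ∑ i ∈ s, (∑ n ∈ t, a i n * x n) ^ 2 ≤ K * ∑ n ∈ t, x n ^ 2 := by
  set b : ι → ℝ := fun i => ∑ n ∈ t, a i n * x n with hb
  set S := ∑ i ∈ s, b i ^ 2 with hS
  have hS0 : 0 ≤ S := by positivity
  have hdual : S = ∑ n ∈ t, x n * ∑ i ∈ s, b i * a i n := by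
    simp_rw [hS, Finset.mul_sum]
    rw [Finset.sum_comm]
    refine Finset.sum_congr rfl fun i _ => ?_
    rw [sq]
    conv_lhs => rw [hb]
    rw [Finset.mul_sum]
    exact Finset.sum_congr rfl fun n _ => by ring
  have hgram : ∑ n ∈ t, (∑ i ∈ s, b i * a i n) ^ 2 ≤ K * S := by
    set G : ι → ι → ℝ := fun i j => ∑ n ∈ t, a i n * a j n with hG
    have hGsymm : ∀ i j, G i j = G j i := fun i j =>
      Finset.sum_congr rfl fun n _ => mul_comm _ _
    have hG0 : ∀ i j, 0 ≤ G i j := fun i j =>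
      Finset.sum_nonneg fun n _ => mul_nonneg (ha i n) (ha j n)
    have hexp : ∑ n ∈ t, (∑ i ∈ s, b i * a i n) ^ 2 = ∑ i ∈ s, ∑ j ∈ s, b i * b j * G i j := by
      simp_rw [sq, Finset.sum_mul_sum]
      rw [Finset.sum_comm]
      refine Finset.sum_congr rfl fun i _ => ?_
      rw [Finset.sum_comm]
      refine Finset.sum_congr rfl fun j _ => ?_
      rw [hG, Finset.mul_sum]
      exact Finset.sum_congr rfl fun n _ => by ring
    have hrow : ∑ i ∈ s, ∑ j ∈ s, b i ^ 2 * G i j ≤ K * S := by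
      rw [hS, Finset.mul_sum]
      refine Finset.sum_le_sum fun i hi => ?_
      rw [← Finset.mul_sum, mul_comm]
      exact mul_le_mul_of_nonneg_right (h i hi) (sq_nonneg _)
    have hcol : ∑ i ∈ s, ∑ j ∈ s, b j ^ 2 * G i j ≤ K * S := by
      rw [Finset.sum_comm]
      simpa only [hGsymm] using hrow
    have hamgm : ∑ i ∈ s, ∑ j ∈ s, b i * b j * G i j ≤
        (∑ i ∈ s, ∑ j ∈ s, b i ^ 2 * G i j + ∑ i ∈ s, ∑ j ∈ s, b j ^ 2 * G i j) / 2 := by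
      simp_rw [← Finset.sum_add_distrib, Finset.sum_div]
      refine Finset.sum_le_sum fun i _ => Finset.sum_le_sum fun j _ => ?_
      nlinarith [mul_nonneg (sq_nonneg (b i - b j)) (hG0 i j)]
    linarith
  have hCS : S ^ 2 ≤ (∑ n ∈ t, x n ^ 2) * (K * S) := by
    calc S ^ 2 = (∑ n ∈ t, x n * ∑ i ∈ s, b i * a i n) ^ 2 := by rw [← hdual]
      _ ≤ (∑ n ∈ t, x n ^ 2) * ∑ n ∈ t, (∑ i ∈ s, b i * a i n) ^ 2 :=
        Finset.sum_mul_sq_le_sq_mul_sq _ _ _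
      _ ≤ _ := by gcongr
  rcases hS0.eq_or_lt with h0 | hpos
  · rw [← h0]; positivity
  · nlinarith

/-- The divisor bound `τ(n) ≪ n ^ ε`. -/
theorem exists_card_divisors_le_rpow {ε : ℝ} (hε : 0 < ε) :
    ∃ C : ℝ, 0 < C ∧ ∀ n : ℕ, n ≠ 0 → (#n.divisors : ℝ) ≤ C * (n : ℝ) ^ ε := by
  have hl : 0 < Real.log 2 := Real.log_pos one_lt_two
  set M : ℝ := 1 + 1 / (ε * Real.log 2) with hM
  have hM1 : 1 ≤ M := by
    have : 0 < 1 / (ε * Real.log 2) := by positivity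
    linarith
  set N : ℕ := ⌈(2 : ℝ) ^ (1 / ε)⌉₊ with hN
  set c : ℕ → ℝ := fun p => if p < N then M else 1 with hc
  have hc1 : ∀ p, 1 ≤ c p := fun p => by
    simp only [hc]; split_ifs <;> simp [hM1]
  have hlocal : ∀ p k : ℕ, 2 ≤ p → (k : ℝ) + 1 ≤ c p * ((p : ℝ) ^ k) ^ ε := by
    intro p k hp
    have hp2 : (2 : ℝ) ≤ p := by exact_mod_cast hp
    have hp0 : (0 : ℝ) ≤ p := by linarith
    have hpow : ((p : ℝ) ^ k) ^ ε = ((p : ℝ) ^ ε) ^ k := by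
      rw [← Real.rpow_natCast, ← Real.rpow_mul hp0, mul_comm, Real.rpow_mul hp0,
        Real.rpow_natCast]
    rw [hpow]
    simp only [hc]
    split_ifs with hpN
    · have h1 : 1 + ε * Real.log 2 ≤ (p : ℝ) ^ ε := by
        calc 1 + ε * Real.log 2 ≤ Real.exp (ε * Real.log 2) := by
              linarith [Real.add_one_le_exp (ε * Real.log 2)]
          _ = (2 : ℝ) ^ ε := by rw [Real.rpow_def_of_pos two_pos, mul_comm]
          _ ≤ (p : ℝ) ^ ε := by gcongr
      have h2 : 1 + (k : ℝ) * (ε * Real.log 2) ≤ ((p : ℝ) ^ ε) ^ k :=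
        (one_add_mul_le_pow (by nlinarith [mul_pos hε hl]) k).trans (by gcongr)
      calc (k : ℝ) + 1 ≤ M * (1 + k * (ε * Real.log 2)) := by
            have : M * (1 + k * (ε * Real.log 2)) = M + k * (ε * Real.log 2) + k := by
              rw [hM]; field_simp; ring
            have : 0 ≤ k * (ε * Real.log 2) := by positivity
            linarith
        _ ≤ _ := by gcongr
    · have hp' : (2 : ℝ) ^ (1 / ε) ≤ p :=
        (Nat.le_ceil _).trans (by exact_mod_cast not_lt.mp hpN)
      have h1 : (2 : ℝ) ≤ (p : ℝ) ^ ε := by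
        calc (2 : ℝ) = ((2 : ℝ) ^ (1 / ε)) ^ ε := by
              rw [← Real.rpow_mul zero_le_two, one_div_mul_cancel hε.ne', Real.rpow_one]
          _ ≤ _ := by gcongr
      calc (k : ℝ) + 1 ≤ 2 ^ k := by exact_mod_cast Nat.lt_two_pow_self
        _ ≤ ((p : ℝ) ^ ε) ^ k := by gcongr
        _ = _ := (one_mul _).symm
  refine ⟨M ^ N, by positivity, fun n hn => ?_⟩
  have hn_prod : (n : ℝ) ^ ε = ∏ p ∈ n.primeFactors, ((p : ℝ) ^ n.factorization p) ^ ε := by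
    rw [Real.finsetProd_rpow _ _ fun p _ => by positivity]
    congr 1
    exact_mod_cast (Nat.prod_factorization_pow_eq_self hn).symm
  have hc_prod : ∏ p ∈ n.primeFactors, c p ≤ M ^ N := by
    calc ∏ p ∈ n.primeFactors, c p = ∏ p ∈ n.primeFactors with p < N, M := by
          rw [Finset.prod_filter]
      _ ≤ M ^ N := by
          rw [Finset.prod_const]
          refine pow_le_pow_right₀ hM1 ?_
          refine (Finset.card_le_card (t := range N) fun p hp => ?_).trans_eq (card_range N)
          exact Finset.mem_range.2 (Finset.mem_filter.1 hp).2
  calc (#n.divisors : ℝ) = ∏ p ∈ n.primeFactors, ((n.factorization p : ℝ) + 1) := by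
        rw [Nat.card_divisors hn]; push_cast; rfl
    _ ≤ ∏ p ∈ n.primeFactors, c p * ((p : ℝ) ^ n.factorization p) ^ ε :=
        Finset.prod_le_prod (fun p _ => by positivity) fun p hp =>
          hlocal p _ (Nat.prime_of_mem_primeFactors hp).two_le
    _ = (∏ p ∈ n.primeFactors, c p) * (n : ℝ) ^ ε := by
        rw [Finset.prod_mul_distrib, hn_prod]
    _ ≤ M ^ N * (n : ℝ) ^ ε := by gcongr

theorem card_dyadic_filter_dvd_le {Y : ℝ} (hY : 0 ≤ Y) {m : ℤ} (hm : 0 < m) :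
    (#{n ∈ Icc ⌈Y⌉ ⌊2 * Y⌋ | m ∣ n} : ℝ) ≤ Y / m + 1 := by
  have hm' : (0 : ℝ) < m := by exact_mod_cast hm
  have hsub : {n ∈ Icc ⌈Y⌉ ⌊2 * Y⌋ | m ∣ n} ⊆
      (Icc ⌈Y / m⌉ ⌊2 * Y / m⌋).image (m * ·) := by
    intro n hn
    obtain ⟨hn, k, rfl⟩ := Finset.mem_filter.1 hn
    rw [Finset.mem_Icc, Int.ceil_le, Int.le_floor] at hn
    push_cast at hn
    refine Finset.mem_image.2 ⟨k, ?_, rfl⟩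
    rw [Finset.mem_Icc, Int.ceil_le, Int.le_floor, div_le_iff₀' hm', le_div_iff₀' hm']
    exact hn
  have hcard := (Finset.card_le_card hsub).trans Finset.card_image_le
  rw [Int.card_Icc] at hcard
  have hYm : 0 ≤ Y / m := by positivity
  have htoNat : (((⌊2 * Y / m⌋ + 1 - ⌈Y / m⌉).toNat : ℤ) : ℝ) ≤ Y / m + 1 := by
    rw [Int.toNat_eq_max]
    push_cast
    refine max_le ?_ (by linarith)
    have h1 := Int.floor_le (2 * Y / m)
    have h2 := Int.le_ceil (Y / m)
    rw [mul_div_assoc] at h1 ⊢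
    linarith
  calc (#{n ∈ Icc ⌈Y⌉ ⌊2 * Y⌋ | m ∣ n} : ℝ)
      ≤ ((⌊2 * Y / m⌋ + 1 - ⌈Y / m⌉).toNat : ℝ) := by exact_mod_cast hcard
    _ ≤ Y / m + 1 := by exact_mod_cast htoNat

theorem sum_gcd_dyadic_le {D : ℝ} (hD : 1 ≤ D) {d : ℤ} (hd : d ∈ Icc ⌈D⌉ ⌊2 * D⌋) :
    ∑ e ∈ Icc ⌈D⌉ ⌊2 * D⌋, (Int.gcd d e : ℝ) ≤ 3 * D * #d.natAbs.divisors := by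
  rw [Finset.mem_Icc, Int.ceil_le, Int.le_floor] at hd
  have hd0 : 0 < d := by exact_mod_cast (by linarith : (0 : ℝ) < d)
  calc ∑ e ∈ Icc ⌈D⌉ ⌊2 * D⌋, (Int.gcd d e : ℝ)
      ≤ ∑ e ∈ Icc ⌈D⌉ ⌊2 * D⌋, ∑ g ∈ d.natAbs.divisors,
          if (g : ℤ) ∣ e then (g : ℝ) else 0 := by
        refine Finset.sum_le_sum fun e _ => ?_
        have hmem : Int.gcd d e ∈ d.natAbs.divisors :=
          Nat.mem_divisors.2 ⟨Nat.gcd_dvd_left _ _, by omega⟩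
        refine le_trans ?_ (Finset.single_le_sum
          (f := fun g : ℕ => if (g : ℤ) ∣ e then (g : ℝ) else 0)
          (fun g _ => by positivity) hmem)
        simp [Int.gcd_dvd_right]
    _ = ∑ g ∈ d.natAbs.divisors, (#{e ∈ Icc ⌈D⌉ ⌊2 * D⌋ | (g : ℤ) ∣ e} : ℝ) * g := by
        rw [Finset.sum_comm]
        refine Finset.sum_congr rfl fun g _ => ?_
        rw [← Finset.sum_filter, Finset.sum_const, nsmul_eq_mul]
    _ ≤ ∑ g ∈ d.natAbs.divisors, 3 * D := by
        refine Finset.sum_le_sum fun g hg => ?_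
        have hg0 : 0 < g := Nat.pos_of_mem_divisors hg
        have hg0' : (0 : ℝ) < g := by exact_mod_cast hg0
        have hgd : (g : ℝ) ≤ d := by
          have : g ≤ d.natAbs := Nat.divisor_le hg
          exact_mod_cast (by omega : (g : ℤ) ≤ d)
        have hcount := card_dyadic_filter_dvd_le (by linarith : 0 ≤ D)
          (by exact_mod_cast hg0 : (0 : ℤ) < g)
        push_cast at hcount
        calc _ ≤ (D / g + 1) * (g : ℝ) := by gcongr
          _ = D + g := by field_simp
          _ ≤ 3 * D := by linarith
    _ = 3 * D * #d.natAbs.divisors := by rw [Finset.sum_const, nsmul_eq_mul, mul_comm]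

theorem card_dyadic_filter_dvd_and_dvd_le {X D : ℝ} (hX : 0 ≤ X) (hD : 0 < D) {d e : ℤ}
    (hd : D ≤ d) (he : D ≤ e) :
    (#{n ∈ Icc ⌈X⌉ ⌊2 * X⌋ | d ∣ n ∧ e ∣ n} : ℝ) ≤ X / D ^ 2 * Int.gcd d e + 1 := by
  have hd0 : 0 < d := by exact_mod_cast hD.trans_le hd
  have he0 : 0 < e := by exact_mod_cast hD.trans_le he
  have hl0 : 0 < Int.lcm d e := Int.lcm_pos hd0.ne' he0.ne'
  have hl0' : (0 : ℝ) < Int.lcm d e := by exact_mod_cast hl0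
  have hmul : (Int.gcd d e : ℝ) * Int.lcm d e = d * e := by
    have : (Int.gcd d e : ℤ) * Int.lcm d e = d * e := by
      rw [← Nat.cast_mul, Int.gcd_mul_lcm, ← Int.natAbs_mul,
        Int.natAbs_of_nonneg (mul_pos hd0 he0).le]
    exact_mod_cast this
  have hcount := card_dyadic_filter_dvd_le hX (by exact_mod_cast hl0 : (0 : ℤ) < Int.lcm d e)
  push_cast at hcount
  calc (#{n ∈ Icc ⌈X⌉ ⌊2 * X⌋ | d ∣ n ∧ e ∣ n} : ℝ)
      ≤ #{n ∈ Icc ⌈X⌉ ⌊2 * X⌋ | (Int.lcm d e : ℤ) ∣ n} := by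
        gcongr with n
        exact fun h => Int.coe_lcm_dvd h.1 h.2
    _ ≤ X / Int.lcm d e + 1 := hcount
    _ ≤ _ := by
        gcongr
        rw [div_mul_eq_mul_div, div_le_div_iff₀ hl0' (by positivity), mul_assoc, hmul]
        gcongr
        nlinarith

theorem large_sieve_type_inequality (ε : ℝ) (hε : 0 < ε) :
    ∃ C : ℝ, 0 < C ∧
      ∀ (X D : ℝ), 1 ≤ X → 1 ≤ D → ∀ ξ : ℤ → ℂ,
        ∑ d ∈ Finset.Icc ⌈D⌉ ⌊2 * D⌋,
            ‖∑ n ∈ (Finset.Icc ⌈X⌉ ⌊2 * X⌋).filter (fun n => d ∣ n), ξ n‖ ^ 2 ≤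
          C * (X * D ^ (ε - 1) + D) * ∑ n ∈ Finset.Icc ⌈X⌉ ⌊2 * X⌋, ‖ξ n‖ ^ 2 := by
  obtain ⟨C, hC, hdiv⟩ := exists_card_divisors_le_rpow hε
  refine ⟨3 * C * 2 ^ ε + 2, by positivity, fun X D hX hD ξ => ?_⟩
  have hD0 : 0 < D := by linarith
  have hX0 : 0 ≤ X := by linarith
  have hrow : ∀ d ∈ Icc ⌈D⌉ ⌊2 * D⌋, ∑ e ∈ Icc ⌈D⌉ ⌊2 * D⌋, ∑ n ∈ Icc ⌈X⌉ ⌊2 * X⌋,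
      (if d ∣ n then (1 : ℝ) else 0) * (if e ∣ n then 1 else 0) ≤
        (3 * C * 2 ^ ε + 2) * (X * D ^ (ε - 1) + D) := by
    intro d hd
    have hd' := hd
    rw [Finset.mem_Icc, Int.ceil_le, Int.le_floor] at hd'
    have hd0 : 0 < d := by exact_mod_cast hD0.trans_le hd'.1
    have hτ : (#d.natAbs.divisors : ℝ) ≤ C * (2 * D) ^ ε := by
      refine (hdiv _ (by omega)).trans ?_
      rw [Nat.cast_natAbs, abs_of_pos hd0]
      gcongr
      exact hd'.2
    have hcard : (#(Icc ⌈D⌉ ⌊2 * D⌋) : ℝ) ≤ 2 * D := by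
      have := card_dyadic_filter_dvd_le hD0.le one_pos
      simp only [one_dvd, Finset.filter_true, Int.cast_one, div_one] at this
      linarith
    calc _ ≤ ∑ e ∈ Icc ⌈D⌉ ⌊2 * D⌋, (X / D ^ 2 * Int.gcd d e + 1) := by
          refine Finset.sum_le_sum fun e he => ?_
          rw [Finset.mem_Icc, Int.ceil_le] at he
          refine le_trans (le_of_eq ?_)
            (card_dyadic_filter_dvd_and_dvd_le hX0 hD0 hd'.1 he.1)
          rw [Finset.card_filter]
          push_cast
          refine Finset.sum_congr rfl fun n _ => ?_
          rw [ite_and, ite_mul, one_mul, zero_mul]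
      _ = X / D ^ 2 * ∑ e ∈ Icc ⌈D⌉ ⌊2 * D⌋, (Int.gcd d e : ℝ) + #(Icc ⌈D⌉ ⌊2 * D⌋) := by
          rw [Finset.sum_add_distrib, Finset.mul_sum, Finset.sum_const, nsmul_one]
      _ ≤ X / D ^ 2 * (3 * D * (C * (2 * D) ^ ε)) + 2 * D := by
          gcongr
          exact (sum_gcd_dyadic_le hD hd).trans (by gcongr)
      _ = 3 * C * 2 ^ ε * (X * D ^ (ε - 1)) + 2 * D := by
          rw [Real.mul_rpow zero_le_two hD0.le, Real.rpow_sub_one hD0.ne']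
          field_simp
      _ ≤ _ := by
          have h1 : 0 ≤ X * D ^ (ε - 1) := by positivity
          have h2 : 0 ≤ 3 * C * (2 : ℝ) ^ ε * D := by positivity
          nlinarith
  refine le_trans ?_ (sum_sq_sum_mul_le_of_gram_row_sum_le
    (a := fun d n : ℤ => if d ∣ n then (1 : ℝ) else 0)
    (fun d n => by positivity) (by positivity) hrow fun n => ‖ξ n‖)
  gcongr with d
  simp only [ite_mul, one_mul, zero_mul, ← Finset.sum_filter]
  exact norm_sum_le _ _
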